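/- Let M > 0 and let r : ℝ² → ℝ be a Schwarzschild double-null radius function with associated background quantities Ω², ω, κ, ρ. Let W, W̲, N, N̲, ϖ, P : ℝ² → ℝ be a smooth solution of the spherically symmetric linearised vacuum Einstein system in double null gauge. With the curvature flux densities G_R(u,v) := r⁴·((Ω²/2)·P² − (3ρ/2)·N·W̲ − (3ρ/2)·(κ/2 − 2ω)·ϖ·W) and G̲_R(u,v) := r⁴·((Ω²/2)·P² − (3ρ/2)·N̲·W + (3ρ/2)·(κ/2 − 2ω)·ϖ·W̲), define the fluxes F_u[ℛ](v₀,v₁) := ∫_{v₀}^{v₁} G_R(u,v) dv and F̲_v[ℛ](u₀,u₁) := ∫_{u₀}^{u₁} G̲_R(u,v) du. Then for all real u₀, u₁, v₀, v₁: F_{u₁}[ℛ](v₀,v₁) + F̲_{v₁}[ℛ](u₀,u₁) = F_{u₀}[ℛ](v₀,v₁) + F̲_{v₀}[ℛ](u₀,u₁). (This is the spherically symmetric case of the conservation law (1.17) of Theorem 1.2, Holzegel's conservation law involving linearised curvature, on a characteristic rectangle of the Schwarzschild exterior.) -/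

import Mathlib

open MeasureTheory Filter Set

/-- Partial derivative in the first (u) variable. -/
noncomputable def pdu (f : ℝ → ℝ → ℝ) (u v : ℝ) : ℝ := deriv (fun x => f x v) u

/-- Partial derivative in the second (v) variable. -/
noncomputable def pdv (f : ℝ → ℝ → ℝ) (u v : ℝ) : ℝ := deriv (fun y => f u y) v

/-- Schwarzschild double-null radius function: smooth, `r > 2M`,
`∂r/∂v = 1 − 2M/r`, `∂r/∂u = −(1 − 2M/r)`. -/
def IsSchwRadius (M : ℝ) (r : ℝ → ℝ → ℝ) : Prop :=
  ContDiff ℝ (⊤ : ℕ∞) (Function.uncurry r) ∧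
  (∀ u v, 2 * M < r u v) ∧
  (∀ u v, pdv r u v = 1 - 2 * M / r u v) ∧
  (∀ u v, pdu r u v = -(1 - 2 * M / r u v))

/-- Background lapse squared `Ω² = 1 − 2M/r`. -/
noncomputable def Om2 (M : ℝ) (r : ℝ → ℝ → ℝ) (u v : ℝ) : ℝ := 1 - 2 * M / r u v

/-- Background `ω = M/r²`. -/
noncomputable def om (M : ℝ) (r : ℝ → ℝ → ℝ) (u v : ℝ) : ℝ := M / (r u v) ^ 2

/-- Background `κ = 2Ω²/r = Ω tr χ`. -/
noncomputable def kap (M : ℝ) (r : ℝ → ℝ → ℝ) (u v : ℝ) : ℝ := 2 * Om2 M r u v / r u v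

/-- Background curvature `ρ = −2M/r³`. -/
noncomputable def rho (M : ℝ) (r : ℝ → ℝ → ℝ) (u v : ℝ) : ℝ := -(2 * M) / (r u v) ^ 3

/-- A smooth solution `(W, W̲, N, N̲, ϖ, P)` of the spherically symmetric linearised
vacuum Einstein system in double null gauge on the Schwarzschild exterior. -/
def IsLinSolution (M : ℝ) (r W Wb N Nb pp P : ℝ → ℝ → ℝ) : Prop :=
  ContDiff ℝ (⊤ : ℕ∞) (Function.uncurry W) ∧
  ContDiff ℝ (⊤ : ℕ∞) (Function.uncurry Wb) ∧
  ContDiff ℝ (⊤ : ℕ∞) (Function.uncurry N) ∧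
  ContDiff ℝ (⊤ : ℕ∞) (Function.uncurry Nb) ∧
  ContDiff ℝ (⊤ : ℕ∞) (Function.uncurry pp) ∧
  ContDiff ℝ (⊤ : ℕ∞) (Function.uncurry P) ∧
  (∀ u v, pdv W u v = (2 * om M r u v - kap M r u v) * W u v + 2 * kap M r u v * N u v) ∧
  (∀ u v, pdu Wb u v = (kap M r u v - 2 * om M r u v) * Wb u v - 2 * kap M r u v * Nb u v) ∧
  (∀ u v, pdv Wb u v =
    2 * Om2 M r u v * (P u v + 2 * rho M r u v * pp u v)
      - (kap M r u v / 2) * (Wb u v - W u v)) ∧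
  (∀ u v, pdu W u v =
    2 * Om2 M r u v * (P u v + 2 * rho M r u v * pp u v)
      - (kap M r u v / 2) * (Wb u v - W u v)) ∧
  (∀ u v, pdv Nb u v = -(Om2 M r u v) * (2 * rho M r u v * pp u v + P u v)) ∧
  (∀ u v, pdu N u v = -(Om2 M r u v) * (2 * rho M r u v * pp u v + P u v)) ∧
  (∀ u v, pdu pp u v = Nb u v) ∧
  (∀ u v, pdv pp u v = N u v) ∧
  (∀ u v, pdv P u v = -(3 / 2) * (kap M r u v * P u v + rho M r u v * W u v)) ∧
  (∀ u v, pdu P u v = (3 / 2) * (kap M r u v * P u v - rho M r u v * Wb u v))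

/-- Curvature flux density along the outgoing cones:
`G_R = r⁴((Ω²/2)P² − (3ρ/2)NW̲ − (3ρ/2)(κ/2 − 2ω)ϖW)`. -/
noncomputable def GR (M : ℝ) (r W Wb N pp P : ℝ → ℝ → ℝ) (u v : ℝ) : ℝ :=
  (r u v) ^ 4 *
    ((Om2 M r u v / 2) * (P u v) ^ 2
      - (3 * rho M r u v / 2) * N u v * Wb u v
      - (3 * rho M r u v / 2) * (kap M r u v / 2 - 2 * om M r u v) * pp u v * W u v)

/-- Curvature flux density along the ingoing cones:
`G̲_R = r⁴((Ω²/2)P² − (3ρ/2)N̲W + (3ρ/2)(κ/2 − 2ω)ϖW̲)`. -/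
noncomputable def GbR (M : ℝ) (r W Wb Nb pp P : ℝ → ℝ → ℝ) (u v : ℝ) : ℝ :=
  (r u v) ^ 4 *
    ((Om2 M r u v / 2) * (P u v) ^ 2
      - (3 * rho M r u v / 2) * Nb u v * W u v
      + (3 * rho M r u v / 2) * (kap M r u v / 2 - 2 * om M r u v) * pp u v * Wb u v)

theorem hasDerivAt_pdu {f : ℝ → ℝ → ℝ} (hf : Differentiable ℝ (Function.uncurry f)) (u v : ℝ) :
    HasDerivAt (fun x => f x v) (pdu f u v) u := by
  have h : DifferentiableAt ℝ (fun x => f x v) u :=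
    (hf (u, v)).comp (f := fun x => (x, v)) u
      (differentiableAt_id.prodMk (differentiableAt_const v))
  exact h.hasDerivAt

theorem hasDerivAt_pdv {f : ℝ → ℝ → ℝ} (hf : Differentiable ℝ (Function.uncurry f)) (u v : ℝ) :
    HasDerivAt (fun y => f u y) (pdv f u v) v := by
  have h : DifferentiableAt ℝ (fun y => f u y) v :=
    (hf (u, v)).comp (f := fun y => (u, y)) v
      ((differentiableAt_const u).prodMk differentiableAt_id)
  exact h.hasDerivAt

theorem fderiv_uncurry_one_zero {f : ℝ → ℝ → ℝ} (hf : Differentiable ℝ (Function.uncurry f))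
    (u v : ℝ) : fderiv ℝ (Function.uncurry f) (u, v) (1, 0) = pdu f u v := by
  have h := (hf (u, v)).hasFDerivAt.comp_hasDerivAt u
    ((hasDerivAt_id u).prodMk (hasDerivAt_const u v))
  exact h.unique (hasDerivAt_pdu hf u v)

theorem fderiv_uncurry_zero_one {f : ℝ → ℝ → ℝ} (hf : Differentiable ℝ (Function.uncurry f))
    (u v : ℝ) : fderiv ℝ (Function.uncurry f) (u, v) (0, 1) = pdv f u v := by
  have h := (hf (u, v)).hasFDerivAt.comp_hasDerivAt v
    ((hasDerivAt_const v u).prodMk (hasDerivAt_id v))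
  exact h.unique (hasDerivAt_pdv hf u v)

/-- A divergence-free pair of densities has conserved fluxes on every characteristic rectangle. -/
theorem integral_add_integral_eq_of_pdu_add_pdv_eq_zero {F G : ℝ → ℝ → ℝ}
    (hF : Differentiable ℝ (Function.uncurry F)) (hG : Differentiable ℝ (Function.uncurry G))
    (h : ∀ u v, pdu F u v + pdv G u v = 0) (u₀ u₁ v₀ v₁ : ℝ) :
    (∫ v in v₀..v₁, F u₁ v) + (∫ u in u₀..u₁, G u v₁) =
      (∫ v in v₀..v₁, F u₀ v) + (∫ u in u₀..u₁, G u v₀) := by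
  have hdiv : ∀ p : ℝ × ℝ, fderiv ℝ (Function.uncurry F) p (1, 0) +
      fderiv ℝ (Function.uncurry G) p (0, 1) = 0 := fun ⟨u, v⟩ => by
    rw [fderiv_uncurry_one_zero hF, fderiv_uncurry_zero_one hG, h]
  have key := integral2_divergence_prod_of_hasFDerivAt (Function.uncurry F) (Function.uncurry G)
    (fderiv ℝ (Function.uncurry F)) (fderiv ℝ (Function.uncurry G)) u₀ v₀ u₁ v₁
    hF.continuous.continuousOn hG.continuous.continuousOn
    (fun p _ => (hF p).hasFDerivAt) (fun p _ => (hG p).hasFDerivAt)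
    (by simp only [hdiv]; exact integrableOn_zero)
  simp only [hdiv, intervalIntegral.integral_zero, Function.uncurry_apply_pair] at key
  linarith

theorem GR_eq {M : ℝ} {r : ℝ → ℝ → ℝ} {u v : ℝ} (hr : r u v ≠ 0) (W Wb N pp P : ℝ → ℝ → ℝ) :
    GR M r W Wb N pp P u v =
      1 / 2 * ((r u v) ^ 4 - 2 * M * (r u v) ^ 3) * (P u v) ^ 2 + 3 * M * r u v * (N u v * Wb u v)
        + (3 * M - 12 * M ^ 2 * (r u v)⁻¹) * (pp u v * W u v) := by
  simp only [GR, Om2, om, kap, rho]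
  field_simp
  ring

theorem GbR_eq {M : ℝ} {r : ℝ → ℝ → ℝ} {u v : ℝ} (hr : r u v ≠ 0) (W Wb Nb pp P : ℝ → ℝ → ℝ) :
    GbR M r W Wb Nb pp P u v =
      1 / 2 * ((r u v) ^ 4 - 2 * M * (r u v) ^ 3) * (P u v) ^ 2 + 3 * M * r u v * (Nb u v * W u v)
        - (3 * M - 12 * M ^ 2 * (r u v)⁻¹) * (pp u v * Wb u v) := by
  simp only [GbR, Om2, om, kap, rho]
  field_simp
  ring

theorem differentiable_uncurry_GR {M : ℝ} {r W Wb N pp P : ℝ → ℝ → ℝ} (hr0 : ∀ u v, r u v ≠ 0)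
    (hr : Differentiable ℝ (Function.uncurry r)) (hW : Differentiable ℝ (Function.uncurry W))
    (hWb : Differentiable ℝ (Function.uncurry Wb)) (hN : Differentiable ℝ (Function.uncurry N))
    (hpp : Differentiable ℝ (Function.uncurry pp)) (hP : Differentiable ℝ (Function.uncurry P)) :
    Differentiable ℝ (Function.uncurry (GR M r W Wb N pp P)) := by
  have hinv := hr.inv fun p => hr0 p.1 p.2
  have hcoeff := ((hr.pow 4).sub ((hr.pow 3).const_mul (2 * M))).const_mul (1 / 2)
  have h := (hcoeff.mul (hP.pow 2)).add
    ((hr.const_mul (3 * M)).mul (hN.mul hWb)) |>.add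
    (((hinv.const_mul (12 * M ^ 2)).const_sub (3 * M)).mul (hpp.mul hW))
  exact fun p => (h p).congr_of_eventuallyEq
    (.of_forall fun q => GR_eq (hr0 q.1 q.2) W Wb N pp P)

theorem differentiable_uncurry_GbR {M : ℝ} {r W Wb Nb pp P : ℝ → ℝ → ℝ} (hr0 : ∀ u v, r u v ≠ 0)
    (hr : Differentiable ℝ (Function.uncurry r)) (hW : Differentiable ℝ (Function.uncurry W))
    (hWb : Differentiable ℝ (Function.uncurry Wb)) (hNb : Differentiable ℝ (Function.uncurry Nb))
    (hpp : Differentiable ℝ (Function.uncurry pp)) (hP : Differentiable ℝ (Function.uncurry P)) :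
    Differentiable ℝ (Function.uncurry (GbR M r W Wb Nb pp P)) := by
  have hinv := hr.inv fun p => hr0 p.1 p.2
  have hcoeff := ((hr.pow 4).sub ((hr.pow 3).const_mul (2 * M))).const_mul (1 / 2)
  have h := (hcoeff.mul (hP.pow 2)).add
    ((hr.const_mul (3 * M)).mul (hNb.mul hW)) |>.sub
    (((hinv.const_mul (12 * M ^ 2)).const_sub (3 * M)).mul (hpp.mul hWb))
  exact fun p => (h p).congr_of_eventuallyEq
    (.of_forall fun q => GbR_eq (hr0 q.1 q.2) W Wb Nb pp P)

/-- The curvature flux densities are divergence free. -/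
theorem pdu_GR_add_pdv_GbR_eq_zero {M : ℝ} {r W Wb N Nb pp P : ℝ → ℝ → ℝ}
    (hr0 : ∀ u v, r u v ≠ 0) (hr : IsSchwRadius M r) (hsol : IsLinSolution M r W Wb N Nb pp P)
    (u v : ℝ) : pdu (GR M r W Wb N pp P) u v + pdv (GbR M r W Wb Nb pp P) u v = 0 := by
  obtain ⟨hr, -, hrv, hru⟩ := hr
  obtain ⟨hW, hWb, hN, hNb, hpp, hP, hWv, hWbu, hWbv, hWu, hNbv, hNu, hppu, hppv, hPv, hPu⟩ := hsol
  have hne : ((⊤ : ℕ∞) : WithTop ℕ∞) ≠ 0 := by simp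
  replace hr := hr.differentiable hne
  replace hW := hW.differentiable hne
  replace hWb := hWb.differentiable hne
  replace hN := hN.differentiable hne
  replace hNb := hNb.differentiable hne
  replace hpp := hpp.differentiable hne
  replace hP := hP.differentiable hne
  have hGu := (((((hasDerivAt_pdu hr u v).pow 4).sub
    (((hasDerivAt_pdu hr u v).pow 3).const_mul (2 * M))).const_mul (1 / 2)).mul
    ((hasDerivAt_pdu hP u v).pow 2)).add
    (((hasDerivAt_pdu hr u v).const_mul (3 * M)).mul
      ((hasDerivAt_pdu hN u v).mul (hasDerivAt_pdu hWb u v))) |>.add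
    (((((hasDerivAt_pdu hr u v).inv (hr0 u v)).const_mul (12 * M ^ 2)).const_sub (3 * M)).mul
      ((hasDerivAt_pdu hpp u v).mul (hasDerivAt_pdu hW u v)))
  replace hGu := (hGu.congr_of_eventuallyEq (f₁ := fun x => GR M r W Wb N pp P x v)
    (.of_forall fun x => GR_eq (hr0 x v) W Wb N pp P)).deriv
  have hGv := (((((hasDerivAt_pdv hr u v).pow 4).sub
    (((hasDerivAt_pdv hr u v).pow 3).const_mul (2 * M))).const_mul (1 / 2)).mul
    ((hasDerivAt_pdv hP u v).pow 2)).add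
    (((hasDerivAt_pdv hr u v).const_mul (3 * M)).mul
      ((hasDerivAt_pdv hNb u v).mul (hasDerivAt_pdv hW u v))) |>.sub
    (((((hasDerivAt_pdv hr u v).inv (hr0 u v)).const_mul (12 * M ^ 2)).const_sub (3 * M)).mul
      ((hasDerivAt_pdv hpp u v).mul (hasDerivAt_pdv hWb u v)))
  replace hGv := (hGv.congr_of_eventuallyEq (f₁ := fun y => GbR M r W Wb Nb pp P u y)
    (.of_forall fun y => GbR_eq (hr0 u y) W Wb Nb pp P)).deriv
  rw [pdu, pdv, hGu, hGv]
  simp only [Pi.mul_apply, Pi.pow_apply, Pi.sub_apply, Pi.inv_apply, hru, hrv, hPu, hPv, hNu, hNbv,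
    hWbu, hWv, hWu, hWbv, hppu, hppv, Om2, om, kap, rho]
  have h0 := hr0 u v
  field_simp
  ring

/-- Spherically symmetric case of the conservation law (1.17) of Theorem 1.2 on a
characteristic rectangle: `F_{u₁}[ℛ] + F̲_{v₁}[ℛ] = F_{u₀}[ℛ] + F̲_{v₀}[ℛ]`. -/
theorem curvature_flux_conservation_law
    (M : ℝ) (hM : 0 < M) (r W Wb N Nb pp P : ℝ → ℝ → ℝ)
    (hr : IsSchwRadius M r) (hsol : IsLinSolution M r W Wb N Nb pp P) :
    ∀ u₀ u₁ v₀ v₁ : ℝ,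
      (∫ v in v₀..v₁, GR M r W Wb N pp P u₁ v) +
        (∫ u in u₀..u₁, GbR M r W Wb Nb pp P u v₁) =
      (∫ v in v₀..v₁, GR M r W Wb N pp P u₀ v) +
        (∫ u in u₀..u₁, GbR M r W Wb Nb pp P u v₀) := by
  have hr0 : ∀ u v, r u v ≠ 0 := fun u v => ne_of_gt (by linarith [hr.2.1 u v])
  have hdiv := pdu_GR_add_pdv_GbR_eq_zero hr0 hr hsol
  obtain ⟨hr, -⟩ := hr
  obtain ⟨hW, hWb, hN, hNb, hpp, hP, -⟩ := hsol
  have hne : ((⊤ : ℕ∞) : WithTop ℕ∞) ≠ 0 := by simp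
  exact integral_add_integral_eq_of_pdu_add_pdv_eq_zero
    (differentiable_uncurry_GR hr0 (hr.differentiable hne) (hW.differentiable hne)
      (hWb.differentiable hne) (hN.differentiable hne) (hpp.differentiable hne)
      (hP.differentiable hne))
    (differentiable_uncurry_GbR hr0 (hr.differentiable hne) (hW.differentiable hne)
      (hWb.differentiable hne) (hNb.differentiable hne) (hpp.differentiable hne)
      (hP.differentiable hne)) hdiv
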